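/- arXiv:2408.04390 — 3 statements merged into one kernel-verified Lean document; each statement's English description precedes it below -/
import Mathlib

section
/- Let l be a positive integer and let m₁, …, m_l be positive integers with m = ∑_{i=1}^{l} m_i. Then the total binary-search cost satisfies ∑_{i=1}^{l} (1 + ⌊log₂ m_i⌋) ≤ l · (1 + log₂(m / l)), where the right-hand side is interpreted as a real number, ⌊log₂ m_i⌋ denotes the natural-number base-2 logarithm of m_i, and log₂ on the right is the real base-2 logarithm. -/
/-- Jensen's inequality for the logarithm in base `b > 1`, with equal weights. -/
theorem Real.sum_logb_le_card_mul_logb {ι : Type*} {s : Finset ι} (hs : s.Nonempty) {b : ℝ}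
    (hb : 1 < b) {x : ι → ℝ} (hx : ∀ i ∈ s, 0 < x i) :
    ∑ i ∈ s, Real.logb b (x i) ≤ s.card * Real.logb b ((∑ i ∈ s, x i) / s.card) := by
  have hc : (0 : ℝ) < s.card := by exact_mod_cast hs.card_pos
  have h := strictConcaveOn_log_Ioi.concaveOn.le_map_sum (t := s)
    (w := fun _ ↦ (s.card : ℝ)⁻¹) (p := x) (fun _ _ ↦ by positivity)
    (by simp [hc.ne']) hx
  simp only [smul_eq_mul, ← Finset.mul_sum] at h
  rw [inv_mul_le_iff₀ hc, inv_mul_eq_div] at h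
  simp only [Real.logb, ← Finset.sum_div, ← mul_div_assoc]
  exact div_le_div_of_nonneg_right h (Real.log_pos hb).le

/-- Theorem 1 (paper): the total binary-search cost over `l` chains,
`∑ (1 + ⌊log₂ mᵢ⌋)`, is at most `l · (1 + log₂(m / l))` where `m = ∑ mᵢ`. -/
theorem tuplechain_lookup_upper_bound
    (l : ℕ) (hl : 0 < l) (mi : Fin l → ℕ) (hmi : ∀ i, 0 < mi i)
    (m : ℕ) (hm : m = ∑ i, mi i) :
    ((∑ i, (1 + Nat.log 2 (mi i)) : ℕ) : ℝ) ≤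
      (l : ℝ) * (1 + Real.logb 2 ((m : ℝ) / (l : ℝ))) := by
  have : Nonempty (Fin l) := ⟨⟨0, hl⟩⟩
  have hjensen := Real.sum_logb_le_card_mul_logb Finset.univ_nonempty one_lt_two
    (x := fun i ↦ (mi i : ℝ)) (fun i _ ↦ Nat.cast_pos.mpr (hmi i))
  have hfloor : ∑ i, (Nat.log 2 (mi i) : ℝ) ≤ ∑ i, Real.logb 2 (mi i) :=
    Finset.sum_le_sum fun i _ ↦ Real.natLog_le_logb (mi i) 2
  rw [Finset.card_univ, Fintype.card_fin] at hjensen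
  subst hm
  push_cast
  rw [Finset.sum_add_distrib, mul_add]
  simpa using hfloor.trans hjensen
end

section
/- Let m ≥ 2 be a real number and let l be a real number with 0 < l < m/2. Define f : ℝ → ℝ by f(x) = x · (1 + log₂(m / x)), where log₂ is the real base-2 logarithm. Then f(l) < m. -/
theorem Real.one_add_logb_two_lt {t : ℝ} (ht : 2 < t) : 1 + Real.logb 2 t < t := by
  have hlog2 : (1 / 2 : ℝ) < Real.log 2 := by linarith [Real.log_two_gt_d9]
  have hlog : Real.log (t / 2) ≤ t / 2 - 1 := Real.log_le_sub_one_of_pos (by linarith)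
  rw [Real.log_div (by linarith) two_ne_zero] at hlog
  have hlogb : Real.logb 2 t < t - 1 := by
    rw [Real.logb, div_lt_iff₀ (by linarith)]
    nlinarith
  linarith

/-- Corollary 2: for `m ≥ 2` and `0 < l < m/2`, the TupleChain lookup
upper bound `f(l) = l · (1 + log₂(m/l))` is strictly below `m`. -/
theorem tuplechain_better_than_tss
    (m : ℝ) (hm : 2 ≤ m) (l : ℝ) (hl : 0 < l) (hlm : l < m / 2)
    (f : ℝ → ℝ) (hf : ∀ x, f x = x * (1 + Real.logb 2 (m / x))) :
    f l < m := by
  have ht : 2 < m / l := by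
    rw [lt_div_iff₀ hl]
    linarith
  calc f l = l * (1 + Real.logb 2 (m / l)) := hf l
    _ < l * (m / l) := mul_lt_mul_of_pos_left (Real.one_add_logb_two_lt ht) hl
    _ = m := mul_div_cancel₀ m hl.ne'
end

section
/- Let d be a natural number and let k, f, m_x, m_y : Fin d → ℕ be d-dimensional vectors of natural numbers. Suppose the mask m_x is contained in the mask m_y on every field, i.e., for every i, (m_x i) AND (m_y i) = m_x i (bitwise AND on natural numbers). If k fails to match the marker key, i.e., there exists an i with (k i) AND (m_x i) ≠ (f i) AND (m_x i), then k fails to match the owner entry, i.e., there exists an i with (k i) AND (m_y i) ≠ f i. -/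
/-- Marker property (contrapositive direction): if a key fails to match the
marker key under the coarser mask `m_x`, it fails to match the owner entry
under the finer mask `m_y`. -/
theorem tuplechain_marker_mismatch
    (d : ℕ) (k f mx my : Fin d → ℕ)
    (hsub : ∀ i, mx i &&& my i = mx i)
    (hfail : ∃ i, k i &&& mx i ≠ f i &&& mx i) :
    ∃ i, k i &&& my i ≠ f i := by
  obtain ⟨i, hi⟩ := hfail
  refine ⟨i, fun h => hi ?_⟩
  rw [← h, Nat.and_assoc, Nat.and_comm (my i), hsub]
end
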